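/- Let k and r be positive integers with r < k and let p = (p_1,…,p_k) be a tuple of non-negative integers with S_{p,r} non-empty. Then Pdet(M_β) = |M_{q,r−1}| / |S_{p,r}|, where q = (p_1, p_2−1, p_3−1, …, p_k−1) (with M_{q,r−1} empty if some entry of q is negative), and M_β = (M_{β,i,j})_{i,j∈[k]} is the matrix of events with M_{β,i,j} = J^{f(i)}_{i,j+1} for i∈[k−1] (the index j+1 taken cyclically modulo k) and M_{β,k,j} = Ω for all j∈[k]. -/

import Mathlib

open Finset

/-- The cyclic interval `]i,j]` of `[k] = {1,…,k}`, realized inside `ZMod k`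
(the element `k` of `[k]` is represented by `0 : ZMod k`). -/
def cyc (k : ℕ) [NeZero k] (i j : ZMod k) : Finset (ZMod k) :=
  Finset.univ.filter fun x => 1 ≤ (x - i).val ∧ (x - i).val ≤ (j - i).val

/-- Membership in `𝒮_{p,r}` : each `j ∈ [k]` belongs to exactly `p j` of the sets `S_1,…,S_r`. -/
def SprMem (k r : ℕ) [NeZero k] (p : ZMod k → ℕ) (S : Fin r → Finset (ZMod k)) : Prop :=
  ∀ j : ZMod k, Nat.card {i : Fin r // j ∈ S i} = p j

/-- Membership in `ℳ_{p,r}` : member of `𝒮_{p,r}` all of whose sets are proper subsets of `[k]`. -/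
def MprMem (k r : ℕ) [NeZero k] (p : ZMod k → ℕ) (S : Fin r → Finset (ZMod k)) : Prop :=
  SprMem k r p S ∧ ∀ i, S i ≠ Finset.univ

/-- `|ℳ_{p,r}|`. -/
noncomputable def Mcard (k r : ℕ) [NeZero k] (p : ZMod k → ℕ) : ℕ :=
  Nat.card {S : Fin r → Finset (ZMod k) // MprMem k r p S}

/-- `|𝒮_{p,r}|`. -/
noncomputable def Scard (k r : ℕ) [NeZero k] (p : ZMod k → ℕ) : ℕ :=
  Nat.card {S : Fin r → Finset (ZMod k) // SprMem k r p S}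

/-- `|ℳ_{q,r}|` for an integer-valued tuple `q` (empty if some entry of `q` is negative). -/
noncomputable def McardZ (k r : ℕ) [NeZero k] (q : ZMod k → ℤ) : ℕ :=
  Nat.card {S : Fin r → Finset (ZMod k) //
    (∀ j : ZMod k, (Nat.card {i : Fin r // j ∈ S i} : ℤ) = q j) ∧ ∀ i, S i ≠ Finset.univ}

/-- `alphaRel k S i j` holds iff `j = α(i,S)`. -/
def alphaRel (k : ℕ) [NeZero k] (S : Finset (ZMod k)) (i j : ZMod k) : Prop :=
  if S = Finset.univ then j = i else j ∉ S ∧ cyc k i (j - 1) ⊆ S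

/-- `betaRel k S i j` holds iff `j = β(i,S)`. -/
def betaRel (k : ℕ) [NeZero k] (S : Finset (ZMod k)) (i j : ZMod k) : Prop :=
  if S = Finset.univ then j = i else j + 1 ∉ S ∧ cyc k i j ⊆ S

/-- `gammaRel k S i j` holds iff `j = γ(i,S)`. -/
def gammaRel (k : ℕ) [NeZero k] (S : Finset (ZMod k)) (i j : ZMod k) : Prop :=
  if S = Finset.univ then j = i
  else if i ∈ S then j = i - 1
  else j + 1 ∉ S ∧ cyc k i j ⊆ S

/-- The digraph on `[k]` with the `k-1` arcs `(i, ζ(i, S_{f i}))` for `i ∈ [k-1]`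
(the nonzero elements of `ZMod k`) is a tree, i.e. a spanning tree oriented toward
the root `k` (represented by `0`): following the arcs from any vertex reaches the root. -/
def GIsTree (k r : ℕ) [NeZero k] (zeta : Finset (ZMod k) → ZMod k → ZMod k → Prop)
    (S : Fin r → Finset (ZMod k)) (f : {i : ZMod k // i ≠ 0} → Fin r) : Prop :=
  ∃ g : ZMod k → ZMod k, g 0 = 0 ∧
    (∀ i : {i : ZMod k // i ≠ 0}, zeta (S (f i)) i.1 (g i.1)) ∧
    ∀ x : ZMod k, ∃ n : ℕ, g^[n] x = 0

/-- Sample space: pairs of a tuple `S ∈ ℳ_{p,r}` and a surjection `f : [k-1] → [r]`,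
with the uniform probability measure. -/
abbrev OmM (k r : ℕ) [NeZero k] (p : ZMod k → ℕ) : Type :=
  {om : (Fin r → Finset (ZMod k)) × ({i : ZMod k // i ≠ 0} → Fin r) //
    MprMem k r p om.1 ∧ Function.Surjective om.2}

/-- Sample space `Ω`: pairs of a tuple `S ∈ 𝒮_{p,r}` and a surjection `f : [k-1] → [r]`,
with the uniform probability measure. -/
abbrev OmS (k r : ℕ) [NeZero k] (p : ZMod k → ℕ) : Type :=
  {om : (Fin r → Finset (ZMod k)) × ({i : ZMod k // i ≠ 0} → Fin r) //
    SprMem k r p om.1 ∧ Function.Surjective om.2}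

/-- Uniform probability of an event `A` in a (finite) sample space `Om`. -/
noncomputable def PrU {Om : Type} (A : Set Om) : ℚ :=
  (Nat.card A : ℚ) / (Nat.card Om : ℚ)

/-- The `Pr`-determinant of a `k × k` matrix of events (rows and columns indexed by
`[k]`, i.e. by `ZMod k`). -/
noncomputable def Pdet {k : ℕ} [NeZero k] {Om : Type} (E : ZMod k → ZMod k → Set Om) : ℚ :=
  ∑ pi : Equiv.Perm (ZMod k), ((Equiv.Perm.sign pi : ℤ) : ℚ) * PrU (⋂ i : ZMod k, E i (pi i))

/-- The matrix of events `M_α`: `M_{α,i,j} = I^{f(i)}_{i,j}` for `i ∈ [k-1]`, and the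
row of `i = k` (i.e. `0`) is constant equal to `Ω`. -/
def Malpha (k r : ℕ) [NeZero k] (p : ZMod k → ℕ) (i j : ZMod k) : Set (OmS k r p) :=
  {om : OmS k r p | ∀ hi : i ≠ 0, cyc k i j ⊆ om.1.1 (om.1.2 ⟨i, hi⟩)}

/-- The matrix of events `M_β`: `M_{β,i,j} = J^{f(i)}_{i,j+1}` for `i ∈ [k-1]`, and the
row of `i = k` (i.e. `0`) is constant equal to `Ω`. -/
def Mbeta (k r : ℕ) [NeZero k] (p : ZMod k → ℕ) (i j : ZMod k) : Set (OmS k r p) :=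
  {om : OmS k r p | ∀ hi : i ≠ 0,
    if i = j + 1 then om.1.1 (om.1.2 ⟨i, hi⟩) = Finset.univ
    else cyc k i (j + 1) ⊆ om.1.1 (om.1.2 ⟨i, hi⟩)}

/-- Membership of `om` in the event `J^{f(i)}_{a,b}`. -/
def Jmem (k r : ℕ) [NeZero k] (p : ZMod k → ℕ) (om : OmS k r p)
    (i : {i : ZMod k // i ≠ 0}) (a b : ZMod k) : Prop :=
  if a = b then om.1.1 (om.1.2 i) = Finset.univ else cyc k a b ⊆ om.1.1 (om.1.2 i)

section Arcs

variable {k : ℕ} [NeZero k]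

theorem zmod_val_sub (a b : ZMod k) :
    (a - b).val = if b.val ≤ a.val then a.val - b.val else k + a.val - b.val := by
  have ha := a.val_lt
  have hb := b.val_lt
  split_ifs with h
  · exact ZMod.val_sub h
  · have h1 := ZMod.val_add_val_of_le (a := a - b) (b := b)
    have h2 := ZMod.val_add (a - b) b
    have h3 := (a - b).val_lt
    rw [sub_add_cancel] at h1 h2
    by_cases h4 : k ≤ (a - b).val + b.val
    · have := h1 h4
      omega
    · rw [Nat.mod_eq_of_lt (by omega)] at h2
      omega

theorem zmod_val_add_one (a : ZMod k) :
    (a + 1).val = if a.val + 1 = k then 0 else a.val + 1 := by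
  have ha := a.val_lt
  rw [ZMod.val_add]
  by_cases hk : k = 1
  · subst hk
    rw [Nat.mod_one, if_pos (by omega)]
  · have : Fact (1 < k) := ⟨by have := NeZero.ne k; omega⟩
    rw [ZMod.val_one]
    split_ifs with h
    · simp [h]
    · exact Nat.mod_eq_of_lt (by omega)

theorem mem_cyc_iff (i j x : ZMod k) : x ∈ cyc k i j ↔
    (i.val < x.val ∧ x.val ≤ j.val) ∨ (j.val < i.val ∧ (i.val < x.val ∨ x.val ≤ j.val)) := by
  have := i.val_lt
  have := j.val_lt
  have := x.val_lt
  simp only [cyc, Finset.mem_filter, Finset.mem_univ, true_and, zmod_val_sub]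
  split_ifs <;> omega

theorem cyc_self (i : ZMod k) : cyc k i i = ∅ := by
  ext x
  simp only [mem_cyc_iff, Finset.notMem_empty, iff_false]
  omega

theorem left_notMem_cyc (i j : ZMod k) : i ∉ cyc k i j := by
  rw [mem_cyc_iff]
  omega

theorem add_one_notMem_cyc (i j : ZMod k) : j + 1 ∉ cyc k i j := by
  have := i.val_lt
  have := j.val_lt
  rw [mem_cyc_iff, zmod_val_add_one]
  split_ifs <;> omega

/-- The cyclic interval `]i, j + 1]`, read as all of `[k]` when `i = j + 1`. -/
def longArc (i j : ZMod k) : Finset (ZMod k) := insert (j + 1) (cyc k i j)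

theorem longArc_eq (i j : ZMod k) :
    longArc i j = if i = j + 1 then Finset.univ else cyc k i (j + 1) := by
  have := i.val_lt
  have := j.val_lt
  ext x
  have := x.val_lt
  split_ifs with h <;>
  · simp only [longArc, Finset.mem_insert, mem_cyc_iff, Finset.mem_univ, iff_true,
      ← (ZMod.val_injective k).eq_iff, zmod_val_add_one] at h ⊢
    split_ifs at h ⊢ <;> omega

theorem disjoint_longArc {i i' j j' : ZMod k} (hne : i ≠ i') (h : i' ∉ cyc k i j)
    (h' : i ∉ cyc k i' j') : Disjoint (longArc i j) (longArc i' j') := by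
  have := i.val_lt
  have := j.val_lt
  have := i'.val_lt
  have := j'.val_lt
  rw [Finset.disjoint_left]
  intro x
  have := x.val_lt
  rw [Ne, ← (ZMod.val_injective k).eq_iff] at hne
  simp only [longArc, Finset.mem_insert, mem_cyc_iff, ← (ZMod.val_injective k).eq_iff,
    zmod_val_add_one] at h h' ⊢
  split_ifs <;> omega

variable {R : Type*} [CommRing R]

/-- The product of the weights `u` over the cyclic interval `]i, j]`. -/
def arcProd (u : ZMod k → R) (i j : ZMod k) : R := ∏ l ∈ cyc k i j, u l

theorem arcProd_self (u : ZMod k → R) (i : ZMod k) : arcProd u i i = 1 := by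
  simp [arcProd, cyc_self]

theorem arcProd_eq_prod_ite (u : ZMod k → R) (i j : ZMod k) :
    arcProd u i j = ∏ l, if l ∈ cyc k i j then u l else 1 := by
  simp [arcProd]

theorem arcProd_mul_arcProd (u : ZMod k → R) {i m j : ZMod k} (h : m = i ∨ m ∈ cyc k i j) :
    arcProd u i m * arcProd u m j = arcProd u i j := by
  simp only [arcProd_eq_prod_ite, ← Finset.prod_mul_distrib]
  refine Finset.prod_congr rfl fun l _ => ?_
  rw [← (ZMod.val_injective k).eq_iff, mem_cyc_iff] at h
  by_cases h1 : l ∈ cyc k i m <;> by_cases h2 : l ∈ cyc k m j <;> by_cases h3 : l ∈ cyc k i j <;>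
  simp only [h1, h2, h3, if_true, if_false, one_mul, mul_one] <;>
  · rw [mem_cyc_iff] at h1 h2 h3
    omega

theorem arcProd_mul_arcProd_wrap (u : ZMod k → R) {i m j : ZMod k} (hi : m ≠ i)
    (h : m ∉ cyc k i j) :
    arcProd u i m * arcProd u m j = (∏ l, u l) * arcProd u i j := by
  simp only [arcProd_eq_prod_ite, ← Finset.prod_mul_distrib]
  refine Finset.prod_congr rfl fun l _ => ?_
  rw [Ne, ← (ZMod.val_injective k).eq_iff] at hi
  rw [mem_cyc_iff] at h
  by_cases h1 : l ∈ cyc k i m <;> by_cases h2 : l ∈ cyc k m j <;> by_cases h3 : l ∈ cyc k i j <;>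
  simp only [h1, h2, h3, if_true, if_false, one_mul, mul_one] <;>
  · rw [mem_cyc_iff] at h1 h2 h3
    omega

end Arcs

section Matrices

variable {k : ℕ} [NeZero k] {R : Type*} [CommRing R] {κ : Type*}

/-- The matrix whose `(i, j)` entry is the product over `]i, j + 1]` of the weights attached to the
colour of `i`. -/
def arcMatrix (c : ZMod k → κ) (u : κ → ZMod k → R) : Matrix (ZMod k) (ZMod k) R :=
  Matrix.of fun i j => ∏ l ∈ longArc i j, u (c i) l

theorem det_arcMatrix_eq_zero {c : ZMod k → κ} {u : κ → ZMod k → R} {i j : ZMod k}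
    (hc : c i ≠ c j) (hi : ∀ l, u (c i) l = 1) (hj : ∀ l, u (c j) l = 1) :
    (arcMatrix c u).det = 0 := by
  refine Matrix.det_zero_of_row_eq (i := i) (j := j) (fun h => hc (by rw [h])) ?_
  funext l
  simp [arcMatrix, hi, hj]

variable [DecidableEq κ]

/-- The matrix obtained from `arcMatrix` by cutting row `i` at the first element after `i` with the
same colour. -/
def cutMatrix (c : ZMod k → κ) (u : κ → ZMod k → R) : Matrix (ZMod k) (ZMod k) R :=
  Matrix.of fun i j => if ∀ l ∈ cyc k i j, c l ≠ c i then ∏ l ∈ longArc i j, u (c i) l else 0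

/-- The transition matrix between `cutMatrix` and `arcMatrix`. -/
def linkMatrix (c : ZMod k → κ) (u : κ → ZMod k → R) : Matrix (ZMod k) (ZMod k) R :=
  Matrix.of fun i j => if c i = c j then arcProd (u (c i)) i j else 0

theorem prod_longArc (u : ZMod k → R) (i j : ZMod k) :
    ∏ l ∈ longArc i j, u l = u (j + 1) * arcProd u i j := by
  rw [longArc, Finset.prod_insert (add_one_notMem_cyc i j), arcProd]

/-- For each column `j`, exactly one `m` of the colour of `i` has an uncut entry: the last one
before `j`. -/
theorem exists_last_of_colour (c : ZMod k → κ) (i j : ZMod k) :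
    ∃ m, c m = c i ∧ (m = i ∨ m ∈ cyc k i j) ∧ (∀ l ∈ cyc k m j, c l ≠ c m) ∧
      ∀ m', c m' = c i → (∀ l ∈ cyc k m' j, c l ≠ c m') → m' = m := by
  obtain ⟨m, hm, hmin⟩ := Finset.exists_min_image (Finset.univ.filter fun m => c m = c i)
    (fun m => (j - m).val) ⟨i, by simp⟩
  simp only [Finset.mem_filter, Finset.mem_univ, true_and] at hm hmin
  have hj := j.val_lt
  have hmk := m.val_lt
  have hcut : ∀ l ∈ cyc k m j, c l ≠ c m := by
    intro l hl hc
    have h := hmin l (hc.trans hm)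
    have := l.val_lt
    rw [mem_cyc_iff] at hl
    rw [zmod_val_sub, zmod_val_sub] at h
    split_ifs at h <;> omega
  refine ⟨m, hm, ?_, hcut, fun m' hc' hcut' => ?_⟩
  · have h : i ∉ cyc k m j := fun h => hcut i h hm.symm
    have := i.val_lt
    rw [mem_cyc_iff] at h ⊢
    rw [← (ZMod.val_injective k).eq_iff]
    omega
  · have h : m' ∉ cyc k m j := fun h => hcut m' h (hc'.trans hm.symm)
    have h' : m ∉ cyc k m' j := fun h => hcut' m h (hm.trans hc'.symm)
    have := m'.val_lt
    rw [mem_cyc_iff] at h h'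
    rw [← (ZMod.val_injective k).eq_iff]
    omega

theorem linkMatrix_mul_cutMatrix (c : ZMod k → κ) (u : κ → ZMod k → R) :
    linkMatrix c u * cutMatrix c u = arcMatrix c u := by
  ext i j
  obtain ⟨m, hm, him, hcut, huniq⟩ := exists_last_of_colour c i j
  rw [Matrix.mul_apply, Finset.sum_eq_single m]
  · simp only [linkMatrix, cutMatrix, arcMatrix, Matrix.of_apply]
    rw [if_pos hm.symm, if_pos hcut, hm, prod_longArc, prod_longArc, mul_left_comm,
      arcProd_mul_arcProd _ him]
  · intro m' _ hne
    simp only [linkMatrix, cutMatrix, Matrix.of_apply]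
    by_cases h1 : c i = c m'
    · rw [if_neg fun h2 => hne (huniq m' h1.symm h2), mul_zero]
    · rw [if_neg h1, zero_mul]
  · simp

theorem det_of_triangular {n : Type*} [Fintype n] [DecidableEq n] (v : n → ℕ)
    (hv : Function.Injective v) (M : Matrix n n R) (h : ∀ i j, v j < v i → M i j = 0) :
    M.det = ∏ i, M i i := by
  let _ : LinearOrder n := LinearOrder.lift' v hv
  exact Matrix.det_of_isUpperTriangular fun i j hij => h i j hij

/-- `i` is the least element of its colour class. -/
def IsFirst (c : ZMod k → κ) (i : ZMod k) : Prop := ∀ j, c j = c i → i.val ≤ j.val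

instance (c : ZMod k → κ) : DecidablePred (IsFirst c) := fun _ => Fintype.decidableForallFintype

theorem exists_isFirst (c : ZMod k → κ) (i : ZMod k) : ∃ m, c m = c i ∧ IsFirst c m := by
  obtain ⟨m, hm, hmin⟩ := Finset.exists_min_image (Finset.univ.filter fun m => c m = c i)
    ZMod.val ⟨i, by simp⟩
  simp only [Finset.mem_filter, Finset.mem_univ, true_and] at hm hmin
  exact ⟨m, hm, fun j hj => hmin j (hj.trans hm)⟩

theorem det_linkMatrix (c : ZMod k → κ) (u : κ → ZMod k → R) :
    (linkMatrix c u).det = ∏ i, if IsFirst c i then 1 else 1 - ∏ l, u (c i) l := by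
  choose m hmc hm using exists_isFirst c
  have hval := ZMod.val_injective k
  let L : Matrix (ZMod k) (ZMod k) R := Matrix.of fun i j =>
    (if i = j then 1 else 0) - if ¬ IsFirst c i ∧ m i = j then arcProd (u (c i)) i (m i) else 0
  have hmul : ∀ i j, (L * linkMatrix c u) i j = linkMatrix c u i j -
      if IsFirst c i then 0 else arcProd (u (c i)) i (m i) * linkMatrix c u (m i) j := by
    intro i j
    simp only [L, Matrix.mul_apply, Matrix.of_apply, sub_mul, Finset.sum_sub_distrib, ite_mul,
      one_mul, zero_mul]
    by_cases h : IsFirst c i <;> simp [h]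
  have hlt : ∀ i, ¬ IsFirst c i → (m i).val < i.val := by
    intro i hi
    refine lt_of_le_of_ne (hm i i (hmc i).symm) fun h => hi ?_
    rw [← hval h]
    exact hm i
  have hentry : ∀ i j, ¬ IsFirst c i → (L * linkMatrix c u) i j =
      if c i = c j ∧ i.val ≤ j.val then (1 - ∏ l, u (c i) l) * arcProd (u (c i)) i j else 0 := by
    intro i j hi
    have hlti := hlt i hi
    rw [hmul, if_neg hi]
    simp only [linkMatrix, Matrix.of_apply, hmc]
    by_cases hc : c i = c j
    · have hle := hm i j (hc.symm.trans (hmc i).symm)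
      rw [if_pos hc, if_pos hc]
      by_cases hij : i.val ≤ j.val
      · rw [if_pos ⟨hc, hij⟩, arcProd_mul_arcProd_wrap, sub_mul, one_mul]
        · rintro h
          rw [h] at hlti
          omega
        · rw [mem_cyc_iff]
          omega
      · rw [if_neg fun h => hij h.2, arcProd_mul_arcProd, sub_self]
        right
        rw [mem_cyc_iff]
        omega
    · simp [hc]
  have hL : L.det = 1 := by
    rw [← Matrix.det_transpose, det_of_triangular ZMod.val hval]
    · refine Finset.prod_eq_one fun i _ => ?_
      simp only [L, Matrix.transpose_apply, Matrix.of_apply, if_true]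
      rw [if_neg, sub_zero]
      rintro ⟨h1, h2⟩
      have := hlt i h1
      rw [h2] at this
      omega
    · intro i j hij
      simp only [L, Matrix.transpose_apply, Matrix.of_apply]
      rw [if_neg (fun h => by rw [h] at hij; omega), if_neg, sub_zero]
      rintro ⟨h1, h2⟩
      have := hlt j h1
      rw [h2] at this
      omega
  have hdet : (L * linkMatrix c u).det = (linkMatrix c u).det := by
    rw [Matrix.det_mul, hL, one_mul]
  rw [← hdet, det_of_triangular ZMod.val hval]
  · refine Finset.prod_congr rfl fun i _ => ?_
    by_cases hi : IsFirst c i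
    · rw [hmul]
      simp [hi, linkMatrix, arcProd_self]
    · rw [hentry i i hi]
      simp [hi, arcProd_self]
  · intro i j hij
    by_cases hi : IsFirst c i
    · rw [hmul, if_pos hi, sub_zero]
      simp only [linkMatrix, Matrix.of_apply]
      rw [if_neg]
      intro h
      have := hi j h.symm
      omega
    · rw [hentry i j hi, if_neg]
      omega

theorem card_isFirst (c : ZMod k → κ) :
    (Finset.univ.filter (IsFirst c)).card = (Finset.univ.image c).card := by
  rw [← Finset.card_image_of_injOn (f := c) (s := Finset.univ.filter (IsFirst c))]
  · congr 1
    ext t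
    simp only [Finset.mem_image, Finset.mem_filter, Finset.mem_univ, true_and]
    constructor
    · rintro ⟨i, -, rfl⟩
      exact ⟨i, rfl⟩
    · rintro ⟨i, rfl⟩
      obtain ⟨m, hm, hf⟩ := exists_isFirst c i
      exact ⟨m, hf, hm⟩
  · intro i hi j hj hij
    simp only [Finset.coe_filter, Finset.mem_univ, true_and, Set.mem_ofPred_eq] at hi hj
    exact ZMod.val_injective k (le_antisymm (hi j hij.symm) (hj i hij))

theorem det_cutMatrix_eq_zero [IsDomain R] {c : ZMod k → κ} {u : κ → ZMod k → R} {i j : ZMod k}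
    (hc : c i ≠ c j) (hi : ∀ l, u (c i) l = 1) (hj : ∀ l, u (c j) l = 1) :
    (cutMatrix c u).det = 0 := by
  rw [← Matrix.exists_vecMul_eq_zero_iff]
  refine ⟨linkMatrix c u i - linkMatrix c u j, fun h => ?_, ?_⟩
  · have := congrFun h i
    simp [linkMatrix, arcProd_self, hc.symm] at this
  · have h := fun i => congrFun (linkMatrix_mul_cutMatrix c u) i
    have hrow : ∀ i, Matrix.vecMul (linkMatrix c u i) (cutMatrix c u) = arcMatrix c u i := fun i => by
      rw [← h i, Matrix.mul_apply_eq_vecMul]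
    rw [Matrix.sub_vecMul, hrow, hrow, sub_eq_zero]
    funext l
    simp [arcMatrix, hi, hj]

end Matrices

section Averaging

variable {k : ℕ} [NeZero k] {R : Type*} [CommRing R] {κ : Type*}

/-- The weight of a subset when each `l` is chosen with weight `u l` and avoided with weight
`1 - u l`. -/
def subsetWeight (u : ZMod k → R) (S : Finset (ZMod k)) : R :=
  (∏ l ∈ S, u l) * ∏ l ∈ Sᶜ, (1 - u l)

/-- The indicator functions of a family of sets. -/
def indic (R : Type*) [CommRing R] {κ : Type*} (S : κ → Finset (ZMod k)) (t : κ) (l : ZMod k) : R :=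
  if l ∈ S t then 1 else 0

theorem prod_indic (S : κ → Finset (ZMod k)) (t : κ) (A : Finset (ZMod k)) :
    ∏ l ∈ A, indic R S t l = if A ⊆ S t then 1 else 0 := by
  simp only [indic, Finset.prod_ite_zero, Finset.prod_const_one, Finset.subset_iff]

theorem sum_subsetWeight_of_subset (u : ZMod k → R) (A : Finset (ZMod k)) :
    ∑ S, subsetWeight u S * (if A ⊆ S then 1 else 0) = ∏ l ∈ A, u l := by
  have h := Fintype.prod_add u fun l => if l ∈ A then 0 else 1 - u l
  have h1 : ∏ l, (u l + if l ∈ A then 0 else 1 - u l) = ∏ l ∈ A, u l := by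
    rw [← Finset.prod_subset (Finset.subset_univ A)]
    · exact Finset.prod_congr rfl fun l hl => by simp [hl]
    · intro l _ hl
      simp [hl]
  rw [← h1, h]
  refine Finset.sum_congr rfl fun S _ => ?_
  by_cases hA : A ⊆ S
  · rw [if_pos hA, mul_one, subsetWeight]
    congr 1
    refine Finset.prod_congr rfl fun l hl => ?_
    rw [if_neg fun h => Finset.mem_compl.1 hl (hA h)]
  · obtain ⟨l, hlA, hlS⟩ := Finset.not_subset.1 hA
    rw [if_neg hA, mul_zero]
    refine (mul_eq_zero_of_right _ (Finset.prod_eq_zero (Finset.mem_compl.2 hlS) ?_)).symm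
    exact if_pos hlA

theorem sum_subsetWeight_ne_univ (u : ZMod k → R) :
    ∑ S, (if S ≠ Finset.univ then subsetWeight u S else 0) = 1 - ∏ l, u l := by
  have h1 := sum_subsetWeight_of_subset u ∅
  have h2 := sum_subsetWeight_of_subset u Finset.univ
  simp only [Finset.empty_subset, if_true, mul_one, Finset.prod_empty] at h1
  rw [← h1, ← h2, ← Finset.sum_sub_distrib]
  refine Finset.sum_congr rfl fun S _ => ?_
  by_cases hS : S = Finset.univ <;> simp [hS, Finset.univ_subset_iff]

variable [Fintype κ] [DecidableEq κ]

theorem prod_longArc_colour {c : ZMod k → κ} {g : ZMod k → ZMod k}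
    (h : ∀ i, ∀ l ∈ cyc k i (g i), c l ≠ c i) (u : κ → ZMod k → R) :
    ∏ i, ∏ l ∈ longArc i (g i), u (c i) l =
      ∏ t, ∏ l ∈ (Finset.univ.filter fun i => c i = t).biUnion fun i => longArc i (g i), u t l := by
  rw [← Finset.prod_fiberwise Finset.univ c]
  refine Finset.prod_congr rfl fun t _ => ?_
  rw [Finset.prod_biUnion]
  · refine Finset.prod_congr rfl fun i hi => ?_
    rw [(Finset.mem_filter.1 hi).2]
  · intro i hi i' hi' hne
    simp only [Finset.coe_filter, Finset.mem_univ, true_and, Set.mem_ofPred_eq] at hi hi'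
    exact disjoint_longArc hne (fun hl => h i i' hl (hi'.trans hi.symm))
      fun hl => h i' i hl (hi.trans hi'.symm)

theorem sum_weight_mul_prod_cutMatrix (c : ZMod k → κ) (u : κ → ZMod k → R)
    (g : ZMod k → ZMod k) :
    ∑ S : κ → Finset (ZMod k), (∏ t, subsetWeight (u t) (S t)) *
      ∏ i, cutMatrix c (indic R S) i (g i) = ∏ i, cutMatrix c u i (g i) := by
  by_cases h : ∀ i, ∀ l ∈ cyc k i (g i), c l ≠ c i
  · have hcut : ∀ v : κ → ZMod k → R, ∏ i, cutMatrix c v i (g i) = ∏ t, ∏ l ∈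
        (Finset.univ.filter fun i => c i = t).biUnion fun i => longArc i (g i), v t l := by
      intro v
      rw [← prod_longArc_colour h]
      exact Finset.prod_congr rfl fun i _ => if_pos (h i)
    simp only [hcut, prod_indic, ← Finset.prod_mul_distrib]
    rw [← Fintype.prod_sum fun t (S : Finset (ZMod k)) => subsetWeight (u t) S *
      if (Finset.univ.filter fun i => c i = t).biUnion (fun i => longArc i (g i)) ⊆ S then 1 else 0]
    simp only [sum_subsetWeight_of_subset]
  · obtain ⟨i, hi⟩ := not_forall.1 h
    have hzero : ∀ v : κ → ZMod k → R, ∏ i, cutMatrix c v i (g i) = 0 := fun v =>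
      Finset.prod_eq_zero (Finset.mem_univ i) (if_neg hi)
    simp [hzero]

theorem sum_weight_mul_det_cutMatrix (c : ZMod k → κ) (u : κ → ZMod k → R) :
    ∑ S : κ → Finset (ZMod k), (∏ t, subsetWeight (u t) (S t)) * (cutMatrix c (indic R S)).det =
      (cutMatrix c u).det := by
  have hdet : ∀ v : κ → ZMod k → R, (cutMatrix c v).det =
      ∑ σ : Equiv.Perm (ZMod k), ((Equiv.Perm.sign σ : ℤ) : R) * ∏ i, cutMatrix c v i (σ i) := by
    intro v
    rw [← Matrix.det_transpose, Matrix.det_apply']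
    rfl
  simp only [hdet, Finset.mul_sum]
  rw [Finset.sum_comm]
  refine Finset.sum_congr rfl fun σ _ => ?_
  rw [← sum_weight_mul_prod_cutMatrix, Finset.mul_sum]
  exact Finset.sum_congr rfl fun S _ => mul_left_comm _ _ _

end Averaging

section Colourings

variable {k r : ℕ}

/-- The colouring of `[k]` extending `f`, where the root has its own colour `none`. -/
def colour (f : {i : ZMod k // i ≠ 0} → Fin r) (i : ZMod k) : Option (Fin r) :=
  if h : i = 0 then none else some (f ⟨i, h⟩)

theorem colour_zero (f : {i : ZMod k // i ≠ 0} → Fin r) : colour f 0 = none := by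
  simp [colour]

theorem colour_of_ne (f : {i : ZMod k // i ≠ 0} → Fin r) {i : ZMod k} (h : i ≠ 0) :
    colour f i = some (f ⟨i, h⟩) := by
  simp [colour, h]

theorem isFirst_colour_zero (f : {i : ZMod k // i ≠ 0} → Fin r) : IsFirst (colour f) 0 := by
  intro j _
  simp

variable [NeZero k]

/-- The extension of a family of sets assigning the full set to the colour of the root. -/
def withUniv (S : Fin r → Finset (ZMod k)) (o : Option (Fin r)) : Finset (ZMod k) :=
  o.elim Finset.univ S

theorem det_arcMatrix_indic {R : Type*} [CommRing R] [IsDomain R]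
    {f : {i : ZMod k // i ≠ 0} → Fin r} (hf : Function.Surjective f)
    (S : Fin r → Finset (ZMod k)) :
    (arcMatrix (colour f) (indic R (withUniv S))).det =
      (cutMatrix (colour f) (indic R (withUniv S))).det := by
  by_cases h : ∃ t, S t = Finset.univ
  · obtain ⟨t, ht⟩ := h
    obtain ⟨⟨i, hi⟩, rfl⟩ := hf t
    have hc : colour f i ≠ colour f 0 := by simp [colour, hi]
    have h1 : ∀ l, indic R (withUniv S) (colour f i) l = 1 := fun l => by
      simp [indic, withUniv, colour_of_ne f hi, ht]
    have h2 : ∀ l, indic R (withUniv S) (colour f 0) l = 1 := fun l => by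
      simp [indic, withUniv, colour_zero]
    rw [det_arcMatrix_eq_zero hc h1 h2, det_cutMatrix_eq_zero hc h1 h2]
  · rw [← linkMatrix_mul_cutMatrix, Matrix.det_mul, det_linkMatrix, Finset.prod_eq_one, one_mul]
    intro i _
    split_ifs with hi
    · rfl
    · have hi0 : i ≠ 0 := fun h0 => hi (h0 ▸ isFirst_colour_zero f)
      rw [prod_indic, if_neg, sub_zero]
      rw [Finset.univ_subset_iff, colour_of_ne f hi0]
      exact fun h' => h ⟨_, h'⟩

variable {K : Type*} [CommRing K]

/-- The weights equal to `v`, except for the colour of the root whose weights are `1`. -/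
def withOne (v : ZMod k → K) (o : Option (Fin r)) : ZMod k → K := o.elim 1 fun _ => v

theorem det_linkMatrix_colour (f : {i : ZMod k // i ≠ 0} → Fin r) (v : ZMod k → K) :
    (linkMatrix (colour f) (withOne v)).det =
      (1 - ∏ l, v l) ^ (k - (Finset.univ.image (colour f)).card) := by
  have hcard : (Finset.univ.filter fun i => ¬ IsFirst (colour f) i).card =
      k - (Finset.univ.image (colour f)).card := by
    have := Finset.card_filter_add_card_filter_not (s := Finset.univ) (IsFirst (colour f))
    rw [card_isFirst, Finset.card_univ, ZMod.card] at this
    omega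
  rw [det_linkMatrix, ← hcard, Finset.prod_ite, Finset.prod_const_one, one_mul]
  refine Finset.prod_eq_pow_card fun i hi => ?_
  have hi0 : i ≠ 0 := fun h0 => (Finset.mem_filter.1 hi).2 (h0 ▸ isFirst_colour_zero f)
  simp [colour_of_ne f hi0, withOne]

theorem arcMatrix_withOne (f g : {i : ZMod k // i ≠ 0} → Fin r) (v : ZMod k → K) :
    arcMatrix (colour f) (withOne v) = arcMatrix (colour g) (withOne v) := by
  ext i j
  by_cases hi : i = 0
  · simp [arcMatrix, hi, colour_zero]
  · simp [arcMatrix, colour_of_ne _ hi, withOne]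

theorem card_image_colour {f : {i : ZMod k // i ≠ 0} → Fin r} (hf : Function.Surjective f) :
    (Finset.univ.image (colour f)).card = r + 1 := by
  rw [Finset.image_univ_of_surjective, Finset.card_univ, Fintype.card_option, Fintype.card_fin]
  rintro (_ | t)
  · exact ⟨0, colour_zero f⟩
  · obtain ⟨⟨i, hi⟩, rfl⟩ := hf t
    exact ⟨i, colour_of_ne f hi⟩

theorem card_image_colour_const (hk : 1 < k) (t : Fin r) :
    (Finset.univ.image (colour (k := k) fun _ => t)).card = 2 := by
  have : Fact (1 < k) := ⟨hk⟩
  rw [Finset.card_eq_two]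
  refine ⟨none, some t, by simp, ?_⟩
  ext o
  simp only [Finset.mem_image, Finset.mem_univ, true_and, Finset.mem_insert,
    Finset.mem_singleton]
  constructor
  · rintro ⟨i, rfl⟩
    by_cases hi : i = 0
    · simp [hi, colour_zero]
    · simp [colour_of_ne _ hi]
  · rintro (rfl | rfl)
    · exact ⟨0, colour_zero _⟩
    · exact ⟨1, colour_of_ne _ one_ne_zero⟩

theorem cutMatrix_colour_zero (f : {i : ZMod k // i ≠ 0} → Fin r) (v : ZMod k → K) (j : ZMod k) :
    cutMatrix (colour f) (withOne v) 0 j = 1 := by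
  simp only [cutMatrix, Matrix.of_apply, colour_zero]
  rw [if_pos]
  · simp [withOne]
  · intro l hl
    rw [colour_of_ne]
    · simp
    · rintro rfl
      exact left_notMem_cyc _ _ hl

theorem cutMatrix_self (f : {i : ZMod k // i ≠ 0} → Fin r) (v : ZMod k → K) {i : ZMod k}
    (hi : i ≠ 0) : cutMatrix (colour f) (withOne v) i i = v (i + 1) := by
  simp [cutMatrix, cyc_self, prod_longArc, arcProd_self, colour_of_ne f hi, withOne]

theorem cutMatrix_const_of_mem (t : Fin r) (v : ZMod k → K) {i j l : ZMod k} (hi : i ≠ 0)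
    (hl : l ≠ 0) (h : l ∈ cyc k i j) :
    cutMatrix (colour fun _ => t) (withOne v) i j = 0 := by
  simp only [cutMatrix, Matrix.of_apply]
  rw [if_neg]
  intro h'
  exact h' l h (by rw [colour_of_ne _ hi, colour_of_ne _ hl])

theorem cutMatrix_const_neg_one (hk : 1 < k) (t : Fin r) (v : ZMod k → K) :
    cutMatrix (colour fun _ => t) (withOne v) (-1) 0 = v 1 * v 0 := by
  have : Fact (1 < k) := ⟨hk⟩
  have hcyc : cyc k (-1) 0 = {0} := by
    ext x
    have := x.val_lt
    have hneg := zmod_val_add_one (-1 : ZMod k)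
    have := (-1 : ZMod k).val_lt
    rw [neg_add_cancel, ZMod.val_zero] at hneg
    rw [mem_cyc_iff, Finset.mem_singleton, ← (ZMod.val_injective k).eq_iff, ZMod.val_zero]
    split_ifs at hneg; omega
  have hne : (-1 : ZMod k) ≠ 0 := neg_ne_zero.2 one_ne_zero
  simp [cutMatrix, hcyc, prod_longArc, arcProd, colour_zero, colour_of_ne _ hne, withOne]

theorem det_cutMatrix_const (hk : 1 < k) (t : Fin r) (v : ZMod k → K) :
    (cutMatrix (colour fun _ => t) (withOne v)).det =
      (∏ l ∈ Finset.univ.erase 1, v l) * (1 - v 1) := by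
  have : Fact (1 < k) := ⟨hk⟩
  have hne : (0 : ZMod k) ≠ -1 := (neg_ne_zero.2 one_ne_zero).symm
  have hone : (1 : ZMod k).val = 1 := ZMod.val_one k
  have hneg : (-1 : ZMod k).val = k - 1 := by
    have hneg := zmod_val_add_one (-1 : ZMod k)
    rw [neg_add_cancel, ZMod.val_zero] at hneg
    split_ifs at hneg; omega
  rw [← Matrix.det_updateCol_add_smul_self _ hne (-v 1), ← Matrix.det_transpose,
    det_of_triangular (fun i => (i - 1).val)
      ((ZMod.val_injective k).comp (sub_left_injective (b := (1 : ZMod k))))]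
  · rw [← Finset.prod_erase_mul _ _ (Finset.mem_univ (0 : ZMod k))]
    congr 1
    · refine Finset.prod_nbij' (· + 1) (· - 1) ?_ ?_ ?_ ?_ ?_
      · simp
      · simp [sub_eq_zero]
      · simp
      · simp
      · intro i hi
        have hi0 := Finset.ne_of_mem_erase hi
        simp [Matrix.updateCol_ne hi0, cutMatrix_self _ v hi0]
    · simp [cutMatrix_colour_zero, sub_eq_add_neg]
  · intro j i hij
    have hi := i.val_lt
    have hj := j.val_lt
    have hij' : i ≠ 0 ∧ (j = 0 ∨ i.val < j.val) := by
      rw [zmod_val_sub, zmod_val_sub, hone] at hij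
      rw [Ne, ← (ZMod.val_injective k).eq_iff, ← (ZMod.val_injective k).eq_iff, ZMod.val_zero]
      split_ifs at hij <;> omega
    obtain ⟨hi0, hj0⟩ := hij'
    have hiv : i.val ≠ 0 := (ZMod.val_ne_zero i).2 hi0
    rw [Matrix.transpose_apply]
    by_cases hjz : j = 0
    · subst hjz
      rw [Matrix.updateCol_self]
      by_cases hin : i = -1
      · rw [hin, cutMatrix_const_neg_one hk, cutMatrix_self _ v hne.symm]
        simp
      · have hiv' : i.val ≠ k - 1 := fun h => hin (ZMod.val_injective k (h.trans hneg.symm))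
        rw [cutMatrix_const_of_mem t v hi0 (l := -1) hne.symm,
          cutMatrix_const_of_mem t v hi0 (l := -1) hne.symm, smul_zero, add_zero]
        · rw [mem_cyc_iff]
          omega
        · rw [mem_cyc_iff, ZMod.val_zero]
          omega
    · rw [Matrix.updateCol_ne hjz]
      refine cutMatrix_const_of_mem t v hi0 (l := j) hjz ?_
      rw [mem_cyc_iff]
      have := hj0.resolve_left hjz
      omega

theorem det_cutMatrix_colour [IsDomain K] (hr : 0 < r) (hrk : r < k)
    {f : {i : ZMod k // i ≠ 0} → Fin r} (hf : Function.Surjective f) (v : ZMod k → K)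
    (hv : ∏ l, v l ≠ 1) :
    (cutMatrix (colour f) (withOne v)).det =
      (1 - ∏ l, v l) ^ (r - 1) * ((∏ l ∈ Finset.univ.erase 1, v l) * (1 - v 1)) := by
  have hk : 1 < k := by omega
  let t : Fin r := ⟨0, hr⟩
  have h1 := congrArg Matrix.det (linkMatrix_mul_cutMatrix (colour f) (withOne v))
  have h2 := congrArg Matrix.det (linkMatrix_mul_cutMatrix (colour fun _ => t) (withOne v))
  rw [← arcMatrix_withOne f, ← h1, Matrix.det_mul, Matrix.det_mul, det_linkMatrix_colour,
    det_linkMatrix_colour, det_cutMatrix_const hk, card_image_colour hf,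
    card_image_colour_const hk, show k - 2 = (k - (r + 1)) + (r - 1) by omega, pow_add,
    mul_assoc] at h2
  exact (mul_left_cancel₀ (pow_ne_zero _ (sub_ne_zero.2 hv.symm)) h2).symm

end Colourings

section Generating

variable {k r : ℕ} [NeZero k]

theorem subsetWeight_one {K : Type*} [CommRing K] (S : Finset (ZMod k)) (hS : S ≠ Finset.univ) :
    subsetWeight (1 : ZMod k → K) S = 0 := by
  have : ∃ l, l ∉ S := by
    by_contra! h
    exact hS (Finset.eq_univ_iff_forall.2 h)
  obtain ⟨l, hl⟩ := this
  exact mul_eq_zero_of_right _ (Finset.prod_eq_zero (Finset.mem_compl.2 hl) (by simp))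

theorem sum_weight_mul_det_arcMatrix {K : Type*} [CommRing K] [IsDomain K] (hr : 0 < r)
    (hrk : r < k) {f : {i : ZMod k // i ≠ 0} → Fin r} (hf : Function.Surjective f)
    (v : ZMod k → K) (hv : ∏ l, v l ≠ 1) :
    ∑ S : Fin r → Finset (ZMod k), (∏ t, subsetWeight v (S t)) *
        (arcMatrix (colour f) (indic K (withUniv S))).det =
      ∑ S : Fin (r - 1) → Finset (ZMod k), (if ∀ t, S t ≠ Finset.univ then 1 else 0) *
        ((∏ t, subsetWeight v (S t)) * subsetWeight v (Finset.univ.erase 1)) := by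
  have hleft : ∑ S : Fin r → Finset (ZMod k), (∏ t, subsetWeight v (S t)) *
      (arcMatrix (colour f) (indic K (withUniv S))).det =
      (cutMatrix (colour f) (withOne v)).det := by
    rw [← sum_weight_mul_det_cutMatrix]
    refine Fintype.sum_of_injective withUniv (fun S S' h => ?_) _ _ (fun S hS => ?_) fun S => ?_
    · funext t
      exact congrFun h (some t)
    · have h : S none ≠ Finset.univ := by
        refine fun h => hS ⟨fun t => S (some t), ?_⟩
        funext o
        cases o
        · exact h.symm
        · rfl
      rw [Fintype.prod_option]
      simp [withOne, subsetWeight_one _ h]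
    · rw [Fintype.prod_option, det_arcMatrix_indic hf]
      simp [withOne, withUniv, subsetWeight]
  have herase : subsetWeight v (Finset.univ.erase 1) =
      (∏ l ∈ Finset.univ.erase 1, v l) * (1 - v 1) := by
    simp [subsetWeight]
  rw [hleft, det_cutMatrix_colour hr hrk hf v hv, ← sum_subsetWeight_ne_univ, Fintype.sum_pow,
    Finset.sum_mul, ← herase]
  refine Finset.sum_congr rfl fun S _ => ?_
  rw [Finset.prod_ite_zero, ← mul_assoc]
  simp

theorem subsetWeight_div {K : Type*} [Field K] (x : ZMod k → K) (hx : ∀ l, 1 + x l ≠ 0)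
    (S : Finset (ZMod k)) :
    subsetWeight (fun l => x l / (1 + x l)) S = (∏ l ∈ S, x l) / ∏ l, (1 + x l) := by
  have h : ∀ l, 1 - x l / (1 + x l) = 1 / (1 + x l) := fun l => by
    have := hx l
    field_simp
    ring
  simp only [subsetWeight, h, Finset.prod_div_distrib, Finset.prod_const_one]
  rw [div_mul_div_comm, mul_one, Finset.prod_mul_prod_compl]

theorem sum_monomial_mul_det_arcMatrix {K : Type*} [Field K] (hr : 0 < r) (hrk : r < k)
    {f : {i : ZMod k // i ≠ 0} → Fin r} (hf : Function.Surjective f) (x : ZMod k → K)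
    (hx : ∀ l, 1 + x l ≠ 0) (hx' : ∏ l, x l ≠ ∏ l, (1 + x l)) :
    ∑ S : Fin r → Finset (ZMod k), (∏ t, ∏ l ∈ S t, x l) *
        (arcMatrix (colour f) (indic K (withUniv S))).det =
      ∑ S : Fin (r - 1) → Finset (ZMod k), (if ∀ t, S t ≠ Finset.univ then 1 else 0) *
        ((∏ t, ∏ l ∈ S t, x l) * ∏ l ∈ Finset.univ.erase 1, x l) := by
  have hY : ∏ l, (1 + x l) ≠ 0 := Finset.prod_ne_zero_iff.2 fun l _ => hx l
  have h := sum_weight_mul_det_arcMatrix hr hrk hf (fun l => x l / (1 + x l)) (by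
    rwa [Finset.prod_div_distrib, Ne, div_eq_one_iff_eq hY])
  simp only [subsetWeight_div x hx, Finset.prod_div_distrib, Finset.prod_const, Finset.card_univ,
    Fintype.card_fin] at h
  have h' := congrArg (· * (∏ l, (1 + x l)) ^ r) h
  simp only [Finset.sum_mul] at h'
  convert! h' using 2 with S _ S _
  · rw [div_mul_eq_mul_div, div_mul_cancel₀ _ (pow_ne_zero _ hY)]
  · rw [div_mul_div_comm, ← pow_succ, Nat.sub_add_cancel hr, mul_assoc,
      div_mul_cancel₀ _ (pow_ne_zero _ hY)]

/-- The number of sets of the family containing each element. -/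
noncomputable def covering (S : Fin r → Finset (ZMod k)) : ZMod k →₀ ℕ :=
  Finsupp.equivFunOnFinite.symm fun l => Nat.card {t : Fin r // l ∈ S t}

open MvPolynomial in
theorem prod_X_eq_monomial (S : Fin r → Finset (ZMod k)) :
    ∏ t, ∏ l ∈ S t, (X l : MvPolynomial (ZMod k) ℚ) = monomial (covering S) 1 := by
  rw [monomial_eq, Finsupp.prod_fintype _ _ fun _ => pow_zero _]
  have h : ∀ t, ∏ l ∈ S t, (X l : MvPolynomial (ZMod k) ℚ) = ∏ l, if l ∈ S t then X l else 1 := by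
    intro t
    simp
  simp only [h, map_one, one_mul]
  rw [Finset.prod_comm]
  refine Finset.prod_congr rfl fun l _ => ?_
  rw [Finset.prod_ite, Finset.prod_const_one, mul_one, Finset.prod_const]
  simp [covering, Nat.card_eq_fintype_card, Fintype.card_subtype]

open MvPolynomial in
theorem sum_X_mul_det_arcMatrix (hr : 0 < r) (hrk : r < k)
    {f : {i : ZMod k // i ≠ 0} → Fin r} (hf : Function.Surjective f) :
    ∑ S : Fin r → Finset (ZMod k), C (arcMatrix (colour f) (indic ℚ (withUniv S))).det *
        ∏ t, ∏ l ∈ S t, (X l : MvPolynomial (ZMod k) ℚ) =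
      ∑ S : Fin (r - 1) → Finset (ZMod k), (if ∀ t, S t ≠ Finset.univ then 1 else 0) *
        ((∏ t, ∏ l ∈ S t, (X l : MvPolynomial (ZMod k) ℚ)) * ∏ l ∈ Finset.univ.erase 1, X l) := by
  let K := FractionRing (MvPolynomial (ZMod k) ℚ)
  have hinj : Function.Injective (algebraMap (MvPolynomial (ZMod k) ℚ) K) :=
    IsFractionRing.injective _ _
  have hcast : ∀ S : Fin r → Finset (ZMod k),
      algebraMap (MvPolynomial (ZMod k) ℚ) K (C (arcMatrix (colour f) (indic ℚ (withUniv S))).det) =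
        (arcMatrix (colour f) (indic K (withUniv S))).det := by
    intro S
    rw [← RingHom.comp_apply, RingHom.map_det]
    congr 1
    ext i j
    simp [arcMatrix, prod_indic, apply_ite]
  have hne : ∀ l, (1 + X l : MvPolynomial (ZMod k) ℚ) ≠ 0 := fun l h => by
    simpa using congrArg (eval (0 : ZMod k → ℚ)) h
  have hne' : (∏ l, X l : MvPolynomial (ZMod k) ℚ) ≠ ∏ l, (1 + X l) := fun h => by
    have := congrArg (eval (0 : ZMod k → ℚ)) h
    simp [map_prod, Finset.prod_const, NeZero.ne k] at this
  apply hinj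
  have h := sum_monomial_mul_det_arcMatrix hr hrk hf
    (fun l => algebraMap (MvPolynomial (ZMod k) ℚ) K (X l))
    (fun l h => hne l (hinj (by simpa using h)))
    (fun h => hne' (hinj (by simpa [map_prod] using h)))
  simp only [map_sum, map_mul, map_prod, hcast, apply_ite (algebraMap (MvPolynomial (ZMod k) ℚ) K),
    map_one, map_zero]
  simpa only [mul_comm] using h

theorem sum_det_arcMatrix (hr : 0 < r) (hrk : r < k)
    {f : {i : ZMod k // i ≠ 0} → Fin r} (hf : Function.Surjective f) (p : ZMod k → ℕ)
    [Fintype {S : Fin r → Finset (ZMod k) // SprMem k r p S}] :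
    ∑ S : {S : Fin r → Finset (ZMod k) // SprMem k r p S},
        (arcMatrix (colour f) (indic ℚ (withUniv S.1))).det =
      McardZ k (r - 1) fun j => if j = 1 then (p j : ℤ) else (p j : ℤ) - 1 := by
  classical
  let P : ZMod k →₀ ℕ := Finsupp.equivFunOnFinite.symm p
  have hP : ∀ S : Fin r → Finset (ZMod k), covering S = P ↔ SprMem k r p S := by
    intro S
    simp [covering, P, SprMem, funext_iff]
  have h := congrArg (MvPolynomial.coeff P) (sum_X_mul_det_arcMatrix hr hrk hf)
  have hQ : ∀ S : Fin (r - 1) → Finset (ZMod k),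
      (∏ t, ∏ l ∈ S t, (MvPolynomial.X l : MvPolynomial (ZMod k) ℚ)) *
        ∏ l ∈ Finset.univ.erase 1, MvPolynomial.X l =
      MvPolynomial.monomial (covering S +
        Finsupp.equivFunOnFinite.symm fun l => if l = 1 then 0 else 1) 1 := by
    intro S
    rw [prod_X_eq_monomial, MvPolynomial.monomial_eq, MvPolynomial.monomial_eq,
      Finsupp.prod_fintype _ _ fun _ => pow_zero _, Finsupp.prod_fintype _ _ fun _ => pow_zero _,
      mul_assoc]
    congr 1
    simp only [Finsupp.add_apply, pow_add, Finset.prod_mul_distrib]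
    congr 1
    rw [← Finset.mul_prod_erase Finset.univ _ (Finset.mem_univ (1 : ZMod k))]
    simp only [Finsupp.equivFunOnFinite_symm_apply_apply, if_true, pow_zero, one_mul]
    refine Finset.prod_congr rfl fun l hl => ?_
    rw [if_neg (Finset.ne_of_mem_erase hl), pow_one]
  have hQ' : ∀ S : Fin (r - 1) → Finset (ZMod k),
      covering S + Finsupp.equivFunOnFinite.symm (fun l => if l = 1 then 0 else 1) = P ↔
        ∀ j, (Nat.card {i // j ∈ S i} : ℤ) = if j = 1 then (p j : ℤ) else (p j : ℤ) - 1 := by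
    intro S
    rw [Finsupp.ext_iff]
    refine forall_congr' fun j => ?_
    simp only [covering, P, Finsupp.add_apply, Finsupp.equivFunOnFinite_symm_apply_apply]
    split_ifs <;> omega
  simp only [hQ] at h
  simp only [prod_X_eq_monomial, MvPolynomial.coeff_sum, ite_mul, one_mul, zero_mul,
    MvPolynomial.coeff_C_mul, MvPolynomial.coeff_monomial, hP, hQ',
    apply_ite (MvPolynomial.coeff P), MvPolynomial.coeff_zero, mul_ite, mul_one, mul_zero,
    ← ite_and] at h
  rw [← Finset.sum_filter, ← Finset.sum_filter, Finset.sum_const, nsmul_one] at h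
  rw [McardZ, Nat.card_eq_fintype_card, Fintype.card_subtype]
  simp only [and_comm] at h ⊢
  rw [← h]
  exact (Finset.sum_subtype (Finset.univ.filter fun S => SprMem k r p S) (fun S => by simp)
    fun S => (arcMatrix (colour f) (indic ℚ (withUniv S))).det).symm

end Generating

section Main

variable {k r : ℕ} [NeZero k]

theorem indicator_Mbeta (p : ZMod k → ℕ) (om : OmS k r p) (i j : ZMod k)
    [Decidable (om ∈ Mbeta k r p i j)] :
    (if om ∈ Mbeta k r p i j then 1 else 0 : ℚ) =
      arcMatrix (colour om.1.2) (indic ℚ (withUniv om.1.1)) i j := by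
  simp only [arcMatrix, Matrix.of_apply, prod_indic]
  refine if_congr ?_ rfl rfl
  by_cases hi : i = 0
  · simp [Mbeta, hi, colour_zero, withUniv]
  · rw [colour_of_ne _ hi, longArc_eq]
    simp only [Mbeta, Set.mem_ofPred_eq, hi, ne_eq, not_false_eq_true, forall_true_left, withUniv,
      Option.elim]
    split_ifs
    · exact Finset.univ_subset_iff.symm
    · rfl

theorem Pdet_Mbeta_eq_sum_det (p : ZMod k → ℕ) [Fintype (OmS k r p)] :
    Pdet (Mbeta k r p) = (∑ om : OmS k r p,
      (arcMatrix (colour om.1.2) (indic ℚ (withUniv om.1.1))).det) / Nat.card (OmS k r p) := by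
  classical
  have hdet : ∀ A : Matrix (ZMod k) (ZMod k) ℚ, A.det =
      ∑ σ : Equiv.Perm (ZMod k), ((Equiv.Perm.sign σ : ℤ) : ℚ) * ∏ i, A i (σ i) := by
    intro A
    rw [← Matrix.det_transpose, Matrix.det_apply']
    rfl
  simp only [hdet]
  rw [Finset.sum_comm, Finset.sum_div, Pdet]
  refine Finset.sum_congr rfl fun σ _ => ?_
  rw [PrU, ← Finset.mul_sum, mul_div_assoc]
  congr 2
  simp only [← indicator_Mbeta, Finset.prod_ite_zero, Finset.prod_const_one]
  rw [Finset.sum_boole, Nat.card_eq_fintype_card, ← Set.toFinset_card]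
  congr 2
  ext om
  simp

theorem exists_surjective_fin (hr : 0 < r) (hrk : r < k) :
    ∃ f : {i : ZMod k // i ≠ 0} → Fin r, Function.Surjective f := by
  have : Nonempty (Fin r) := ⟨⟨0, hr⟩⟩
  have hcard : Fintype.card (Fin r) ≤ Fintype.card {i : ZMod k // i ≠ 0} := by
    rw [Fintype.card_subtype_compl, ZMod.card, Fintype.card_subtype_eq, Fintype.card_fin]
    omega
  obtain ⟨e⟩ := Function.Embedding.nonempty_of_card_le hcard
  exact ⟨Function.invFun e, Function.invFun_surjective e.injective⟩

end Main

/-- Proposition 13: `Pdet(M_β) = |ℳ_{q,r-1}| / |𝒮_{p,r}|`, where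
`q = (p_1, p_2 - 1, …, p_k - 1)`. -/
theorem Pdet_Mbeta (k r : ℕ) [NeZero k] (hr : 0 < r) (hrk : r < k)
    (p : ZMod k → ℕ)
    (hS : Nonempty {S : Fin r → Finset (ZMod k) // SprMem k r p S}) :
    Pdet (Mbeta k r p) =
      (McardZ k (r - 1) (fun j => if j = 1 then (p j : ℤ) else (p j : ℤ) - 1) : ℚ) /
        (Scard k r p : ℚ) := by
  classical
  have hsurj : Nonempty {f : {i : ZMod k // i ≠ 0} → Fin r // Function.Surjective f} := by
    obtain ⟨f, hf⟩ := exists_surjective_fin hr hrk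
    exact ⟨⟨f, hf⟩⟩
  let _ : Fintype {S : Fin r → Finset (ZMod k) // SprMem k r p S} := Fintype.ofFinite _
  let e : OmS k r p ≃ {S : Fin r → Finset (ZMod k) // SprMem k r p S} ×
      {f : {i : ZMod k // i ≠ 0} → Fin r // Function.Surjective f} := Equiv.subtypeProdEquivProd
  have hsum : ∑ om : OmS k r p, (arcMatrix (colour om.1.2) (indic ℚ (withUniv om.1.1))).det =
      Nat.card {f : {i : ZMod k // i ≠ 0} → Fin r // Function.Surjective f} *
        (McardZ k (r - 1) (fun j => if j = 1 then (p j : ℤ) else (p j : ℤ) - 1) : ℚ) := by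
    refine (Fintype.sum_equiv e _
      (fun y => (arcMatrix (colour y.2.1) (indic ℚ (withUniv y.1.1))).det) fun _ => rfl).trans ?_
    rw [Fintype.sum_prod_type_right]
    simp only [fun f : {f : {i : ZMod k // i ≠ 0} → Fin r // Function.Surjective f} =>
      sum_det_arcMatrix hr hrk f.2 p]
    simp
  have hpos : (Nat.card {f : {i : ZMod k // i ≠ 0} → Fin r // Function.Surjective f} : ℚ) ≠ 0 := by
    exact_mod_cast Nat.card_pos.ne'
  rw [Pdet_Mbeta_eq_sum_det, hsum, Nat.card_congr e, Nat.card_prod, Scard, Nat.cast_mul,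
    mul_comm (Nat.card {S : Fin r → Finset (ZMod k) // SprMem k r p S} : ℚ),
    mul_div_mul_left _ _ hpos]
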